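/- arXiv:1504.07449 — 2 statements merged into one kernel-verified Lean document; each statement's English description precedes it below -/
import Mathlib

section
/- Let Γ be a finite simplicial graph satisfying property (B2), and let v, w be distinct vertices with v ≤ w. Then for every integer m ≥ 0, the power t_{vw}^{m²} of the transvection t_{vw} lies in the commutator subgroup of SIA_Γ(m). -/
open SimpleGraph

namespace RaagPaper

variable {V : Type} [Fintype V] [DecidableEq V]

/-- The defining relations of the right-angled Artin group of a graph `Γ`. -/
def Rels (Γ : SimpleGraph V) : Set (FreeGroup V) :=
  {r | ∃ u v : V, Γ.Adj u v ∧
    r = FreeGroup.of u * FreeGroup.of v * (FreeGroup.of u)⁻¹ * (FreeGroup.of v)⁻¹}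

/-- The right-angled Artin group of `Γ`. -/
abbrev Raag (Γ : SimpleGraph V) := PresentedGroup (Rels Γ)

/-- The generator of `Raag Γ` corresponding to the vertex `v`. -/
def gen (Γ : SimpleGraph V) (v : V) : Raag Γ := PresentedGroup.of v

/-- The link of a vertex. -/
def lk (Γ : SimpleGraph V) (v : V) : Set V := Γ.neighborSet v

/-- The star of a vertex. -/
def st (Γ : SimpleGraph V) (v : V) : Set V := insert v (Γ.neighborSet v)

/-- The partial preorder `v ≤ w ↔ lk v ⊆ st w` on vertices. -/
def Le (Γ : SimpleGraph V) (v w : V) : Prop := lk Γ v ⊆ st Γ w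

/-- The equivalence `v ∼ w`. -/
def Sim (Γ : SimpleGraph V) (v w : V) : Prop := Le Γ v w ∧ Le Γ w v

/-- The equivalence class of a vertex under `∼`. -/
def simClass (Γ : SimpleGraph V) (v : V) : Set V := {u | Sim Γ u v}

/-- Property (B1): any two distinct non-adjacent vertices are `∼`-equivalent. -/
def B1 (Γ : SimpleGraph V) : Prop :=
  ∀ u v : V, u ≠ v → ¬ Γ.Adj u v → Sim Γ u v

/-- Property (B2). -/
def B2 (Γ : SimpleGraph V) : Prop :=
  ∀ v w : V, v ≠ w → Le Γ v w → ∃ u : V, u ≠ v ∧ u ≠ w ∧ Le Γ v u ∧ Le Γ u w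

/-- `α` is the transvection `t_{vw}` for some `v ≤ w`. -/
def IsTransvection (Γ : SimpleGraph V) (α : MulAut (Raag Γ)) : Prop :=
  ∃ v w : V, v ≠ w ∧ Le Γ v w ∧ α (gen Γ v) = gen Γ v * gen Γ w ∧
    ∀ z : V, z ≠ v → α (gen Γ z) = gen Γ z

/-- `Y` is (the vertex set of) a connected component of the subgraph of `Γ` induced on `S`. -/
def IsCompOf (Γ : SimpleGraph V) (S : Set V) (Y : Set V) : Prop :=
  ∃ C : (Γ.induce S).ConnectedComponent, Y = Subtype.val '' C.supp

/-- `α` is a partial conjugation `c_{v,Y}`. -/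
def IsPartialConj (Γ : SimpleGraph V) (α : MulAut (Raag Γ)) : Prop :=
  ∃ (v : V) (Y : Set V), IsCompOf Γ (st Γ v)ᶜ Y ∧
    (∀ y ∈ Y, α (gen Γ y) = (gen Γ v)⁻¹ * gen Γ y * gen Γ v) ∧
    (∀ z : V, z ∉ Y → α (gen Γ z) = gen Γ z)

/-- `α` is the inversion `ι_v`. -/
def IsInversion (Γ : SimpleGraph V) (α : MulAut (Raag Γ)) : Prop :=
  ∃ v : V, α (gen Γ v) = (gen Γ v)⁻¹ ∧ ∀ z : V, z ≠ v → α (gen Γ z) = gen Γ z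

/-- `SAut⁰(A_Γ)`: the subgroup generated by transvections and partial conjugations. -/
def SAut0 (Γ : SimpleGraph V) : Subgroup (MulAut (Raag Γ)) :=
  Subgroup.closure {α | IsTransvection Γ α ∨ IsPartialConj Γ α}

/-- `Aut⁰(A_Γ)`: the subgroup generated by transvections, partial conjugations and inversions. -/
def Aut0 (Γ : SimpleGraph V) : Subgroup (MulAut (Raag Γ)) :=
  Subgroup.closure {α | IsTransvection Γ α ∨ IsPartialConj Γ α ∨ IsInversion Γ α}

/-- The natural map `Aut(A_Γ) → Aut(A_Γ^{ab})`. -/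
def abAutHom (Γ : SimpleGraph V) :
    MulAut (Raag Γ) →* MulAut (Abelianization (Raag Γ)) :=
  MonoidHom.mk' (fun e => MulEquiv.abelianizationCongr e) (by
    intro e f
    exact (abelianizationCongr_trans f e).symm)

/-- The Torelli subgroup `IA_Γ`. -/
def IA (Γ : SimpleGraph V) : Subgroup (MulAut (Raag Γ)) := (abAutHom Γ).ker

/-- The subgroup of `m`-th powers of `A_Γ^{ab}`; the quotient by it is `A_Γ^{ab} ⊗ ℤ/mℤ`. -/
def powN (Γ : SimpleGraph V) (m : ℕ) : Subgroup (Abelianization (Raag Γ)) :=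
  (powMonoidHom m : Abelianization (Raag Γ) →* Abelianization (Raag Γ)).range

/-- `IA_Γ(m)`: the kernel of `Aut(A_Γ) → Aut(A_Γ^{ab} ⊗ ℤ/mℤ)`, i.e. the automorphisms
acting trivially on the abelianization modulo `m`-th powers. -/
def IAm (Γ : SimpleGraph V) (m : ℕ) : Subgroup (MulAut (Raag Γ)) where
  carrier := {α | ∀ x : Abelianization (Raag Γ), abAutHom Γ α x * x⁻¹ ∈ powN Γ m}
  one_mem' := by
    intro x
    simp only [map_one, MulAut.one_apply, mul_inv_cancel]
    exact one_mem _
  mul_mem' := by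
    intro a b ha hb x
    have h : abAutHom Γ (a * b) x * x⁻¹ =
        (abAutHom Γ a (abAutHom Γ b x) * (abAutHom Γ b x)⁻¹) * (abAutHom Γ b x * x⁻¹) := by
      simp only [map_mul, MulAut.mul_apply]
      group
    rw [h]
    exact mul_mem (ha _) (hb x)
  inv_mem' := by
    intro a ha x
    have h : abAutHom Γ a (abAutHom Γ a⁻¹ x) = x := by
      have : abAutHom Γ a * abAutHom Γ a⁻¹ = 1 := by
        rw [← map_mul, mul_inv_cancel, map_one]
      calc abAutHom Γ a (abAutHom Γ a⁻¹ x) = (abAutHom Γ a * abAutHom Γ a⁻¹) x := rfl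
        _ = x := by rw [this]; rfl
    have := inv_mem (ha (abAutHom Γ a⁻¹ x))
    rw [h] at this
    simpa [mul_comm] using this
  
/-- `SIA_Γ(m) = SAut⁰(A_Γ) ∩ IA_Γ(m)`. -/
def SIA (Γ : SimpleGraph V) (m : ℕ) : Subgroup (MulAut (Raag Γ)) := SAut0 Γ ⊓ IAm Γ m

/-- The group of inner automorphisms of `A_Γ`. -/
def innSub (Γ : SimpleGraph V) : Subgroup (MulAut (Raag Γ)) :=
  (MulAut.conj : Raag Γ →* MulAut (Raag Γ)).range


/-- Property (NL): three pairwise distinct, pairwise non-adjacent vertices with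
`v₃ ≤ v₁` and `v₃ ≤ v₂`. -/
def NL (Γ : SimpleGraph V) : Prop :=
  ∃ v₁ v₂ v₃ : V, v₁ ≠ v₂ ∧ v₁ ≠ v₃ ∧ v₂ ≠ v₃ ∧
    ¬ Γ.Adj v₁ v₂ ∧ ¬ Γ.Adj v₁ v₃ ∧ ¬ Γ.Adj v₂ v₃ ∧ Le Γ v₃ v₁ ∧ Le Γ v₃ v₂

open Classical in
/-- The multiset of cardinalities of the equivalence classes of vertices under `∼`. -/
noncomputable def classSizes (Γ : SimpleGraph V) : Multiset ℕ :=
  (Finset.image (fun v => Set.toFinset (simClass Γ v)) Finset.univ).val.map Finset.card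

section Substitution

variable {Γ : SimpleGraph V}

lemma gen_commute {u v : V} (h : Γ.Adj u v) : Commute (gen Γ u) (gen Γ v) := by
  have hr : (PresentedGroup.mk (Rels Γ)) (FreeGroup.of u * FreeGroup.of v *
      (FreeGroup.of u)⁻¹ * (FreeGroup.of v)⁻¹) = 1 :=
    PresentedGroup.one_of_mem ⟨u, v, h, rfl⟩
  simp only [map_mul, map_inv] at hr
  exact (mul_inv_eq_iff_eq_mul.mp (mul_inv_eq_one.mp hr))

lemma gen_commute_of_le {v w z : V} (hle : Le Γ v w) (h : Γ.Adj v z) :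
    Commute (gen Γ w) (gen Γ z) := by
  rcases hle h with rfl | hz
  · exact Commute.refl _
  · exact gen_commute hz

/-- Two homomorphisms out of `Raag Γ` agreeing on the generators are equal. -/
lemma raag_hom_ext {G : Type*} [Group G] {f g : Raag Γ →* G}
    (h : ∀ z, f (gen Γ z) = g (gen Γ z)) : f = g :=
  PresentedGroup.ext h

lemma mulAut_ext {α β : MulAut (Raag Γ)} (h : ∀ z, α (gen Γ z) = β (gen Γ z)) : α = β :=
  MulEquiv.toMonoidHom_injective (raag_hom_ext h)

/-- The endomorphism sending `v` to `wⁱ v wʲ` and fixing the other generators. -/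
def substHom (v w : V) (hle : Le Γ v w) (i j : ℤ) : Raag Γ →* Raag Γ :=
  PresentedGroup.toGroup
    (f := fun z => if z = v then gen Γ w ^ i * gen Γ v * gen Γ w ^ j else gen Γ z) (by
      have key : ∀ z, Γ.Adj v z →
          Commute (gen Γ w ^ i * gen Γ v * gen Γ w ^ j) (gen Γ z) := fun z hz =>
        (((gen_commute_of_le hle hz).zpow_left i).mul_left (gen_commute hz)).mul_left
          ((gen_commute_of_le hle hz).zpow_left j)
      rintro _ ⟨a, b, hab, rfl⟩
      simp only [map_mul, map_inv, FreeGroup.lift_apply_of]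
      rw [mul_inv_eq_one, mul_inv_eq_iff_eq_mul]
      change Commute _ _
      by_cases ha : a = v <;> by_cases hb : b = v
      · exact absurd (ha.trans hb.symm) hab.ne
      · subst ha
        simpa [hb] using key b hab
      · subst hb
        simpa [ha] using (key a hab.symm).symm
      · simpa [ha, hb] using gen_commute hab)

lemma substHom_self {v w : V} (hle : Le Γ v w) (i j : ℤ) :
    substHom v w hle i j (gen Γ v) = gen Γ w ^ i * gen Γ v * gen Γ w ^ j :=
  (PresentedGroup.toGroup.of _).trans (if_pos rfl)

lemma substHom_of_ne {v w z : V} (hle : Le Γ v w) (i j : ℤ) (hz : z ≠ v) :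
    substHom v w hle i j (gen Γ z) = gen Γ z :=
  (PresentedGroup.toGroup.of _).trans (if_neg hz)

lemma substHom_comp_neg {v w : V} (hne : v ≠ w) (hle : Le Γ v w) (i j : ℤ) :
    (substHom v w hle (-i) (-j)).comp (substHom v w hle i j) = MonoidHom.id _ := by
  refine raag_hom_ext fun z => ?_
  by_cases hz : z = v
  · subst hz
    simp only [MonoidHom.comp_apply, substHom_self, map_mul, map_zpow,
      substHom_of_ne hle _ _ hne.symm, MonoidHom.id_apply]
    group
  · simp [substHom_of_ne hle _ _ hz]

/-- The automorphism sending `v` to `wⁱ v wʲ` and fixing the other generators. -/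
def substAut (v w : V) (hne : v ≠ w) (hle : Le Γ v w) (i j : ℤ) : MulAut (Raag Γ) :=
  MonoidHom.toMulEquiv (substHom v w hle i j) (substHom v w hle (-i) (-j))
    (substHom_comp_neg hne hle i j)
    (by simpa using substHom_comp_neg hne hle (-i) (-j))

lemma substAut_self {v w : V} (hne : v ≠ w) (hle : Le Γ v w) (i j : ℤ) :
    substAut v w hne hle i j (gen Γ v) = gen Γ w ^ i * gen Γ v * gen Γ w ^ j :=
  substHom_self hle i j

lemma substAut_of_ne {v w z : V} (hne : v ≠ w) (hle : Le Γ v w) (i j : ℤ) (hz : z ≠ v) :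
    substAut v w hne hle i j (gen Γ z) = gen Γ z :=
  substHom_of_ne hle i j hz

lemma mem_IAm_of_gen {α : MulAut (Raag Γ)} {m : ℕ}
    (h : ∀ z, Abelianization.of (α (gen Γ z)) * (Abelianization.of (gen Γ z))⁻¹ ∈ powN Γ m) :
    α ∈ IAm Γ m := by
  let d : Raag Γ →* Abelianization (Raag Γ) :=
    (Abelianization.of.comp α.toMonoidHom) / Abelianization.of
  have hd : ∀ x, d x ∈ powN Γ m := by
    intro x
    have hx : x ∈ Subgroup.closure (Set.range (PresentedGroup.of (rels := Rels Γ))) := by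
      simp [PresentedGroup.closure_range_of]
    induction hx using Subgroup.closure_induction with
    | mem x hx =>
      obtain ⟨z, rfl⟩ := hx
      simpa [d, div_eq_mul_inv, gen] using h z
    | one => simp
    | mul x y _ _ hx hy => simpa using mul_mem hx hy
    | inv x _ hx => simpa using inv_mem hx
  intro x
  obtain ⟨y, rfl⟩ := QuotientGroup.mk_surjective x
  have := hd y
  simp only [d, div_eq_mul_inv] at this
  exact this

lemma transvection_pow_apply {v w : V} (hne : v ≠ w) {t : MulAut (Raag Γ)}
    (htv : t (gen Γ v) = gen Γ v * gen Γ w)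
    (htz : ∀ z : V, z ≠ v → t (gen Γ z) = gen Γ z) (m : ℕ) :
    (t ^ m) (gen Γ v) = gen Γ v * gen Γ w ^ m ∧
      ∀ z : V, z ≠ v → (t ^ m) (gen Γ z) = gen Γ z := by
  induction m with
  | zero => simp
  | succ m ih =>
    refine ⟨?_, fun z hz => ?_⟩
    · rw [pow_succ', MulAut.mul_apply, ih.1, map_mul, map_pow, htv, htz w hne.symm, mul_assoc,
        ← pow_succ']
    · rw [pow_succ', MulAut.mul_apply, ih.2 z hz, htz z hz]

lemma transvection_pow_mem_SIA {v w : V} (hne : v ≠ w) (hle : Le Γ v w)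
    {t : MulAut (Raag Γ)} (htv : t (gen Γ v) = gen Γ v * gen Γ w)
    (htz : ∀ z : V, z ≠ v → t (gen Γ z) = gen Γ z) (m : ℕ) : t ^ m ∈ SIA Γ m := by
  have ht : t ∈ SAut0 Γ := Subgroup.subset_closure (Or.inl ⟨v, w, hne, hle, htv, htz⟩)
  refine ⟨pow_mem ht m, mem_IAm_of_gen fun z => ?_⟩
  obtain ⟨hv, hz⟩ := transvection_pow_apply hne htv htz m
  by_cases h : z = v
  · subst h
    exact ⟨Abelianization.of (gen Γ w), by simp [hv]⟩
  · rw [hz z h, mul_inv_cancel]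
    exact one_mem _

/-- If `v ≤ u` are distinct and non-adjacent, then `{v}` is a component of `Γ - st u`. -/
lemma isCompOf_singleton {u v : V} (hne : v ≠ u) (hle : Le Γ v u) (hadj : ¬ Γ.Adj v u) :
    IsCompOf Γ (st Γ u)ᶜ {v} := by
  have hv : v ∈ (st Γ u)ᶜ := by
    rintro (h | h)
    · exact hne h
    · exact hadj (Γ.adj_symm h)
  refine ⟨(Γ.induce (st Γ u)ᶜ).connectedComponentMk ⟨v, hv⟩, ?_⟩
  ext y
  simp only [Set.mem_singleton_iff, Set.mem_image, SimpleGraph.ConnectedComponent.mem_supp_iff,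
    SimpleGraph.ConnectedComponent.eq]
  constructor
  · rintro rfl
    exact ⟨⟨y, hv⟩, SimpleGraph.Reachable.refl _, rfl⟩
  · rintro ⟨a, ha, rfl⟩
    obtain ⟨p⟩ := ha.symm
    cases p with
    | nil => rfl
    | @cons _ b _ h _ => exact absurd (hle h) b.2

/-- Conjugation of the single generator `v` by `u ≥ v` belongs to `SIA Γ m`. -/
lemma substAut_conj_mem_SIA {u v : V} (hne : v ≠ u) (hle : Le Γ v u) (m : ℕ) :
    substAut v u hne hle (-1) 1 ∈ SIA Γ m := by
  by_cases hadj : Γ.Adj v u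
  · have h1 : substAut v u hne hle (-1) 1 = 1 := by
      refine mulAut_ext fun z => ?_
      by_cases hz : z = v
      · subst hz
        rw [substAut_self, mul_assoc, ((gen_commute hadj).zpow_right 1).eq]
        simp
      · simp [substAut_of_ne hne hle _ _ hz]
    rw [h1]
    exact one_mem _
  · refine ⟨Subgroup.subset_closure (Or.inr ⟨u, {v}, isCompOf_singleton hne hle hadj, ?_,
      fun z hz => substAut_of_ne hne hle _ _ hz⟩), mem_IAm_of_gen fun z => ?_⟩
    · rintro _ rfl
      simp [substAut_self]
    · have : Abelianization.of (substAut v u hne hle (-1) 1 (gen Γ z)) =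
          Abelianization.of (gen Γ z) := by
        by_cases hz : z = v
        · subst hz
          rw [substAut_self, map_mul, map_mul, mul_right_comm, ← map_mul]
          simp
        · rw [substAut_of_ne hne hle _ _ hz]
      rw [this, mul_inv_cancel]
      exact one_mem _

end Substitution

/-- Suppose that conjugation by `b` sends `a` to `a * t` and fixes `t`, and that `d` commutes with
`a` and `t`. If a subgroup `H` contains `a ^ m`, `b ^ m`, `t ^ m` and `a * d`, then `t ^ m ^ 2`
lies in the commutator subgroup of `H`. -/
lemma pow_sq_mem_commutator {G : Type*} [Group G] {H : Subgroup G} {a b d t : G} {m : ℕ}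
    (ha : a ^ m ∈ H) (hb : b ^ m ∈ H) (ht : t ^ m ∈ H) (hd : a * d ∈ H)
    (hba : b * a = a * t * b) (hbt : Commute b t) (hda : Commute d a) (hdt : Commute d t) :
    t ^ (m ^ 2) ∈ ⁅H, H⁆ := by
  have hconj : ∀ n : ℕ, b ^ n * a * (b ^ n)⁻¹ = a * t ^ n := by
    intro n
    induction n with
    | zero => simp
    | succ n ih =>
      calc b ^ (n + 1) * a * (b ^ (n + 1))⁻¹ = b * (b ^ n * a * (b ^ n)⁻¹) * b⁻¹ := by
            rw [pow_succ']; group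
        _ = (b * a) * t ^ n * b⁻¹ := by rw [ih]; group
        _ = a * t * (b * t ^ n) * b⁻¹ := by rw [hba]; group
        _ = a * t ^ (n + 1) := by rw [(hbt.pow_right n).eq, pow_succ']; group
  have hpow : ∀ n : ℕ, a ^ n * t ^ m * (a ^ n)⁻¹ = (a * d) ^ n * t ^ m * ((a * d) ^ n)⁻¹ := by
    intro n
    rw [hda.symm.mul_pow, mul_assoc (a ^ n) (d ^ n), (hdt.pow_pow n m).eq]
    group
  have hstep : ∀ n : ℕ, (t ^ m) ^ n * ((a * t ^ m) ^ n * (a ^ n)⁻¹)⁻¹ ∈ ⁅H, H⁆ := by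
    intro n
    induction n with
    | zero => simp
    | succ n ih =>
      have hk : (t ^ m) ^ n * (a * d) ^ (n + 1) * ((t ^ m) ^ n)⁻¹ ∈ H :=
        mul_mem (mul_mem (pow_mem ht n) (pow_mem hd _)) (inv_mem (pow_mem ht n))
      have hprod : (a * t ^ m) ^ (n + 1) * (a ^ (n + 1))⁻¹ =
          (a * t ^ m) ^ n * (a ^ n)⁻¹ *
            ((a * d) ^ (n + 1) * t ^ m * ((a * d) ^ (n + 1))⁻¹) := by
        rw [← hpow, pow_succ (a * t ^ m), pow_succ a]
        group
      have h := mul_mem (Subgroup.commutator_mem_commutator ht hk) ih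
      rw [hprod]
      convert h using 1
      rw [commutatorElement_def, pow_succ (t ^ m)]
      generalize t ^ m = s
      generalize (a * s) ^ n * (a ^ n)⁻¹ = p
      generalize (a * d) ^ (n + 1) = k
      have hs : s * s ^ n = s ^ n * s := (pow_mul_comm' s n).symm
      generalize s ^ n = q at hs
      have hs' : s⁻¹ * q = q * s⁻¹ := ((show Commute s q from hs).inv_left).eq
      calc q * s * (p * (k * s * k⁻¹))⁻¹ = (q * s) * k * s⁻¹ * k⁻¹ * p⁻¹ := by group
        _ = s * q * k * s⁻¹ * k⁻¹ * p⁻¹ := by rw [hs]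
        _ = s * q * k * (q⁻¹ * (q * s⁻¹)) * k⁻¹ * p⁻¹ := by group
        _ = s * q * k * (q⁻¹ * (s⁻¹ * q)) * k⁻¹ * p⁻¹ := by rw [hs']
        _ = _ := by group
  have hcomm : (a * t ^ m) ^ m * (a ^ m)⁻¹ ∈ ⁅H, H⁆ := by
    have h := Subgroup.commutator_mem_commutator hb ha
    rwa [commutatorElement_def, ← conj_pow, hconj] at h
  have h := mul_mem (hstep m) hcomm
  rwa [inv_mul_cancel_right, ← pow_mul, ← sq] at h

theorem transvection_msq_power_in_commutator (Γ : SimpleGraph V) (hB2 : B2 Γ)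
    (v w : V) (hne : v ≠ w) (hle : Le Γ v w)
    (t : MulAut (Raag Γ))
    (htv : t (gen Γ v) = gen Γ v * gen Γ w)
    (htz : ∀ z : V, z ≠ v → t (gen Γ z) = gen Γ z)
    (m : ℕ) :
    t ^ (m ^ 2) ∈ ⁅SIA Γ m, SIA Γ m⁆ := by
  obtain ⟨u, huv, huw, hvu, huw'⟩ := hB2 v w hne hle
  set a := substAut v u huv.symm hvu 0 1
  set b := substAut u w huw huw' 0 1
  set d := substAut v u huv.symm hvu (-1) 0
  have hav : a (gen Γ v) = gen Γ v * gen Γ u := by simp [a, substAut_self]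
  have haz : ∀ z, z ≠ v → a (gen Γ z) = gen Γ z := fun z hz => substAut_of_ne _ _ _ _ hz
  have hbu : b (gen Γ u) = gen Γ u * gen Γ w := by simp [b, substAut_self]
  have hbz : ∀ z, z ≠ u → b (gen Γ z) = gen Γ z := fun z hz => substAut_of_ne _ _ _ _ hz
  have hdv : d (gen Γ v) = (gen Γ u)⁻¹ * gen Γ v := by simp [d, substAut_self]
  have hdz : ∀ z, z ≠ v → d (gen Γ z) = gen Γ z := fun z hz => substAut_of_ne _ _ _ _ hz
  have had : a * d = substAut v u huv.symm hvu (-1) 1 := by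
    refine mulAut_ext fun z => ?_
    by_cases hzv : z = v
    · subst hzv
      simp [hdv, hav, haz u huv, substAut_self, mul_assoc]
    · simp [haz z hzv, hdz z hzv, substAut_of_ne _ _ _ _ hzv]
  refine pow_sq_mem_commutator (a := a) (b := b) (d := d)
    (transvection_pow_mem_SIA huv.symm hvu hav haz m)
    (transvection_pow_mem_SIA huw huw' hbu hbz m)
    (transvection_pow_mem_SIA hne hle htv htz m)
    (had ▸ substAut_conj_mem_SIA huv.symm hvu m) ?_ ?_ ?_ ?_
  · refine mulAut_ext fun z => ?_
    by_cases hzv : z = v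
    · subst hzv
      simp [hav, htv, hbu, hbz z huv.symm, haz w hne.symm, mul_assoc]
    · by_cases hzu : z = u
      · subst hzu
        simp [haz z hzv, hbu, htz z hzv, htz w hne.symm, haz w hne.symm]
      · simp [haz z hzv, hbz z hzu, htz z hzv]
  · refine mulAut_ext fun z => ?_
    by_cases hzv : z = v
    · subst hzv
      simp [htv, hbz z huv.symm, hbz w huw.symm]
    · by_cases hzu : z = u
      · subst hzu
        simp [hbu, htz z hzv, htz w hne.symm]
      · simp [hbz z hzu, htz z hzv]
  · refine mulAut_ext fun z => ?_
    by_cases hzv : z = v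
    · subst hzv
      simp [hav, hdv, hdz u huv, haz u huv, mul_assoc]
    · simp [haz z hzv, hdz z hzv]
  · refine mulAut_ext fun z => ?_
    by_cases hzv : z = v
    · subst hzv
      simp [htv, hdv, hdz w hne.symm, htz u huv, mul_assoc]
    · simp [htz z hzv, hdz z hzv]

end RaagPaper
end

section
/- Let Γ be a finite simplicial graph satisfying property (B2), and let H denote the image of SAut⁰(A_Γ) under the natural homomorphism Aut(A_Γ) → Aut(A_Γ^{ab}). Then H is perfect, i.e. H equals its own commutator subgroup. -/
open SimpleGraph

namespace RaagPaper

variable {V : Type} [Fintype V] [DecidableEq V]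

open scoped commutatorElement

theorem commute_gen_of_adj {Γ : SimpleGraph V} {u v : V} (h : Γ.Adj u v) :
    Commute (gen Γ u) (gen Γ v) := by
  have hr : (PresentedGroup.mk (Rels Γ)) (FreeGroup.of u * FreeGroup.of v *
      (FreeGroup.of u)⁻¹ * (FreeGroup.of v)⁻¹) = 1 :=
    PresentedGroup.one_of_mem ⟨u, v, h, rfl⟩
  simp only [map_mul, map_inv] at hr
  exact commutatorElement_eq_one_iff_commute.mp hr

theorem commute_gen_of_mem_st {Γ : SimpleGraph V} {z w : V} (h : z ∈ st Γ w) :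
    Commute (gen Γ z) (gen Γ w) := by
  rcases h with rfl | h
  · exact Commute.refl _
  · exact (commute_gen_of_adj h).symm

/-- Right multiplication of the generator `v` by an element `c` commuting with the link of `v`
extends to an endomorphism of the right-angled Artin group. -/
theorem exists_endomorphism_mul_right (Γ : SimpleGraph V) (v : V) (c : Raag Γ)
    (hc : ∀ z ∈ lk Γ v, Commute (gen Γ z) c) :
    ∃ f : Raag Γ →* Raag Γ, f (gen Γ v) = gen Γ v * c ∧ ∀ z, z ≠ v → f (gen Γ z) = gen Γ z := by
  let g : V → Raag Γ := fun z => if z = v then gen Γ v * c else gen Γ z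
  have hv : g v = gen Γ v * c := if_pos rfl
  have hz : ∀ z, z ≠ v → g z = gen Γ z := fun z h => if_neg h
  have hg : ∀ r ∈ Rels Γ, FreeGroup.lift g r = 1 := by
    rintro r ⟨a, b, hab, rfl⟩
    simp only [map_mul, map_inv, FreeGroup.lift_apply_of]
    refine commutatorElement_eq_one_iff_commute.mpr ?_
    by_cases ha : a = v
    · subst ha
      rw [hv, hz b hab.ne']
      exact (commute_gen_of_adj hab).mul_left (hc b hab).symm
    · by_cases hb : b = v
      · subst hb
        rw [hv, hz a ha]
        exact (commute_gen_of_adj hab).mul_right (hc a hab.symm)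
      · rw [hz a ha, hz b hb]
        exact commute_gen_of_adj hab
  exact ⟨PresentedGroup.toGroup hg, (PresentedGroup.toGroup.of hg).trans hv,
    fun z h => (PresentedGroup.toGroup.of hg).trans (hz z h)⟩

theorem exists_transvection {Γ : SimpleGraph V} {v w : V} (hvw : v ≠ w) (h : Le Γ v w) :
    ∃ α : MulAut (Raag Γ), α (gen Γ v) = gen Γ v * gen Γ w ∧
      ∀ z, z ≠ v → α (gen Γ z) = gen Γ z := by
  have hc : ∀ z ∈ lk Γ v, Commute (gen Γ z) (gen Γ w) := fun z hz => commute_gen_of_mem_st (h hz)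
  obtain ⟨f, hfv, hf⟩ := exists_endomorphism_mul_right Γ v (gen Γ w) hc
  obtain ⟨g, hgv, hg⟩ :=
    exists_endomorphism_mul_right Γ v (gen Γ w)⁻¹ fun z hz => (hc z hz).inv_right
  have hgf : g.comp f = MonoidHom.id _ := by
    refine PresentedGroup.ext fun z => ?_
    change g (f (gen Γ z)) = gen Γ z
    by_cases hz : z = v
    · rw [hz, hfv, map_mul, hgv, hg w hvw.symm, inv_mul_cancel_right]
    · rw [hf z hz, hg z hz]
  have hfg : f.comp g = MonoidHom.id _ := by
    refine PresentedGroup.ext fun z => ?_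
    change f (g (gen Γ z)) = gen Γ z
    by_cases hz : z = v
    · rw [hz, hgv, map_mul, map_inv, hfv, hf w hvw.symm, mul_inv_cancel_right]
    · rw [hg z hz, hf z hz]
  exact ⟨MonoidHom.toMulEquiv f g hgf hfg, hfv, hf⟩

theorem abAutHom_of (Γ : SimpleGraph V) (α : MulAut (Raag Γ)) (x : Raag Γ) :
    abAutHom Γ α (Abelianization.of x) = Abelianization.of (α x) := rfl

theorem abelianization_mulAut_ext {Γ : SimpleGraph V} {φ ψ : MulAut (Abelianization (Raag Γ))}
    (h : ∀ z, φ (Abelianization.of (gen Γ z)) = ψ (Abelianization.of (gen Γ z))) : φ = ψ := by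
  have hom_eq : φ.toMonoidHom = ψ.toMonoidHom :=
    Abelianization.hom_ext _ _ (PresentedGroup.ext h)
  exact MulEquiv.toMonoidHom_injective hom_eq

theorem abAutHom_eq_one_of_isPartialConj {Γ : SimpleGraph V} {α : MulAut (Raag Γ)}
    (h : IsPartialConj Γ α) : abAutHom Γ α = 1 := by
  obtain ⟨v, Y, -, hY, hnY⟩ := h
  refine abelianization_mulAut_ext fun z => ?_
  rw [abAutHom_of, MulAut.one_apply]
  by_cases hz : z ∈ Y
  · rw [hY z hz, map_mul, map_mul, map_inv, mul_comm, mul_inv_cancel_left]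
  · rw [hnY z hz]

/-- On the abelianization, `t_{vw} = [t_{uw}, t_{vu}]` whenever `v ≤ u ≤ w`. -/
theorem abAutHom_transvection_eq_commutatorElement {Γ : SimpleGraph V} {u v w : V}
    (huv : u ≠ v) (hvw : v ≠ w) {τ α β : MulAut (Raag Γ)}
    (hτv : τ (gen Γ v) = gen Γ v * gen Γ w) (hτ : ∀ z, z ≠ v → τ (gen Γ z) = gen Γ z)
    (hαu : α (gen Γ u) = gen Γ u * gen Γ w) (hα : ∀ z, z ≠ u → α (gen Γ z) = gen Γ z)
    (hβv : β (gen Γ v) = gen Γ v * gen Γ u) (hβ : ∀ z, z ≠ v → β (gen Γ z) = gen Γ z) :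
    abAutHom Γ τ = ⁅abAutHom Γ α, abAutHom Γ β⁆ := by
  rw [commutatorElement_def, eq_mul_inv_iff_mul_eq, eq_mul_inv_iff_mul_eq]
  refine abelianization_mulAut_ext fun z => ?_
  simp only [MulAut.mul_apply, abAutHom_of]
  by_cases hzv : z = v
  · subst hzv
    rw [hα z huv.symm, hβv, map_mul τ, map_mul α, hτv, hτ u huv, hα z huv.symm, hαu]
    simp only [map_mul, mul_assoc]
    rw [mul_comm (Abelianization.of (gen Γ w))]
  · by_cases hzu : z = u
    · subst hzu
      rw [hβ z hzv, hαu, map_mul β, hβ z hzv, hβ w hvw.symm, map_mul τ, hτ z hzv, hτ w hvw.symm]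
    · rw [hα z hzu, hβ z hzv, hτ z hzv, hα z hzu]

theorem image_of_SAut0_perfect_of_B2 (Γ : SimpleGraph V) (hB2 : B2 Γ) :
    commutator ((SAut0 Γ).map (abAutHom Γ)) = ⊤ := by
  have hle : (SAut0 Γ).map (abAutHom Γ) ≤
      ⁅(SAut0 Γ).map (abAutHom Γ), (SAut0 Γ).map (abAutHom Γ)⁆ := by
    rw [Subgroup.map_le_iff_le_comap]
    refine (Subgroup.closure_le _).mpr ?_
    rintro τ (⟨v, w, hvw, hle, hτv, hτ⟩ | hτ)
    · obtain ⟨u, huv, huw, hvu, huw'⟩ := hB2 v w hvw hle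
      obtain ⟨α, hαu, hα⟩ := exists_transvection huw huw'
      obtain ⟨β, hβv, hβ⟩ := exists_transvection huv.symm hvu
      have key := abAutHom_transvection_eq_commutatorElement huv hvw hτv hτ hαu hα hβv hβ
      rw [SetLike.mem_coe, Subgroup.mem_comap, key]
      exact Subgroup.commutator_mem_commutator
        (Subgroup.mem_map_of_mem _ (Subgroup.subset_closure (Or.inl ⟨u, w, huw, huw', hαu, hα⟩)))
        (Subgroup.mem_map_of_mem _
          (Subgroup.subset_closure (Or.inl ⟨v, u, huv.symm, hvu, hβv, hβ⟩)))
    · rw [SetLike.mem_coe, Subgroup.mem_comap, abAutHom_eq_one_of_isPartialConj hτ]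
      exact one_mem _
  rw [← top_le_iff, ← Subgroup.map_subtype_le_map_subtype, Subgroup.map_subtype_commutator]
  exact (Subgroup.map_subtype_le _).trans hle

end RaagPaper
end
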